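/- Assume the numerical bound C_{17}(0.65) ≤ 0.145 (established by numerical evaluation in prior work). Then lim_{d→1⁻} C(d)/(1−d) ≤ 0.4143. -/

import Mathlib

open scoped BigOperators

noncomputable section

/-- Output alphabet of the binary deletion channel with `n` input bits:
a length `k ≤ n` together with a binary string of that length. -/
abbrev DelOut (n : ℕ) := Σ k : Fin (n + 1), (Fin (k : ℕ) → Bool)

/-- The subsequence of `x` indexed by `S` (taken in increasing order),
as an element of `DelOut n`. -/
def restrictSub {n : ℕ} (x : Fin n → Bool) (S : Finset (Fin n)) : DelOut n :=
  ⟨⟨S.card, Nat.lt_succ_of_le (by simpa using Finset.card_le_univ S)⟩,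
   fun i => x (S.orderEmbOfFin rfl i)⟩

/-- Transition probability of the binary deletion channel `W_n^d`: each input bit is
deleted independently with probability `d`. -/
def delW {n : ℕ} (d : ℝ) (x : Fin n → Bool) (y : DelOut n) : ℝ :=
  ∑ S : Finset (Fin n),
    if restrictSub x S = y then (1 - d) ^ S.card * d ^ (n - S.card) else 0

/-- Transition probability of the exact deletion channel `W_{n,k}`, which keeps exactly `k`
of the `n` input bits, the kept positions being a uniformly random `k`-subset; `k`-subsets
are identified with strictly monotone maps `Fin k → Fin n`. -/
def exactW {n k : ℕ} (x : Fin n → Bool) (y : Fin k → Bool) : ℝ :=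
  ((Finset.univ.filter fun f : Fin k → Fin n => StrictMono f ∧ x ∘ f = y).card : ℝ) /
    (n.choose k : ℝ)

/-- `p` is a probability distribution on the finite alphabet `α`. -/
def IsDist {α : Type*} [Fintype α] (p : α → ℝ) : Prop :=
  (∀ a, 0 ≤ p a) ∧ ∑ a, p a = 1

/-- Base-2 mutual information `I(X;Y)` between the input `X ~ p` and the output `Y`
of the channel with transition matrix `W`. -/
def mutualInfo {α β : Type*} [Fintype α] [Fintype β] (p : α → ℝ) (W : α → β → ℝ) : ℝ :=
  ∑ x, ∑ y, p x * W x y * Real.logb 2 (W x y / ∑ x', p x' * W x' y)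

/-- `C_n(d) = (1/n) · sup_p I(X ; W_n^d(X))`. -/
def Cn (n : ℕ) (d : ℝ) : ℝ :=
  (1 / (n : ℝ)) * ⨆ p : {p : (Fin n → Bool) → ℝ // IsDist p}, mutualInfo p.1 (delW d)

/-- `C_{n,k} = (1/n) · sup_p I(X ; W_{n,k}(X))`. -/
def Cnk (n k : ℕ) : ℝ :=
  (1 / (n : ℝ)) * ⨆ p : {p : (Fin n → Bool) → ℝ // IsDist p},
    mutualInfo p.1 (exactW (n := n) (k := k))

/-- Capacity of the binary deletion channel: `C(d) = inf_{n ≥ 1} C_n(d)`. -/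
def C (d : ℝ) : ℝ := ⨅ n : {m : ℕ // 1 ≤ m}, Cn n d

/-! ### The log-sum inequality -/

/-- The log-sum inequality; `V` may exceed the total mass of `v`. -/
lemma log_sum_le {ι : Type*} (s : Finset ι) (w v : ι → ℝ) (V : ℝ)
    (hw : ∀ i ∈ s, 0 ≤ w i) (hv : ∀ i ∈ s, 0 ≤ v i) (hwv : ∀ i ∈ s, 0 < w i → 0 < v i)
    (hV : ∑ i ∈ s, v i ≤ V) :
    (∑ i ∈ s, w i) * (Real.log (∑ i ∈ s, w i) - Real.log V) ≤
      ∑ i ∈ s, w i * (Real.log (w i) - Real.log (v i)) := by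
  set A := ∑ i ∈ s, w i with hA
  have hA0 : 0 ≤ A := Finset.sum_nonneg hw
  rcases hA0.eq_or_lt with h0 | hpos
  · have hz : ∀ i ∈ s, w i = 0 := (Finset.sum_eq_zero_iff_of_nonneg hw).1 h0.symm
    rw [← h0, zero_mul, Finset.sum_eq_zero fun i hi => by rw [hz i hi, zero_mul]]
  · obtain ⟨j, hj, hjw⟩ := Finset.exists_lt_of_sum_lt (s := s) (f := fun _ => (0 : ℝ)) (g := w)
      (by simpa using hpos)
    have hVpos : 0 < V := lt_of_lt_of_le (hwv j hj hjw)
      ((Finset.single_le_sum hv hj).trans hV)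
    have key : ∀ i ∈ s, w i * (Real.log A - Real.log V) + w i - v i * (A / V) ≤
        w i * (Real.log (w i) - Real.log (v i)) := by
      intro i hi
      rcases (hw i hi).eq_or_lt with h | h
      · rw [← h]
        have : 0 ≤ v i * (A / V) := mul_nonneg (hv i hi) (by positivity)
        linarith
      · have hvi := hwv i hi h
        have hl := Real.log_le_sub_one_of_pos (x := v i * A / (w i * V)) (by positivity)
        rw [Real.log_div (by positivity) (by positivity), Real.log_mul hvi.ne' hpos.ne',
          Real.log_mul h.ne' hVpos.ne'] at hl
        have := mul_le_mul_of_nonneg_left hl h.le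
        have e : w i * (v i * A / (w i * V) - 1) = v i * (A / V) - w i := by
          field_simp
        rw [e] at this
        linarith
    have hs := Finset.sum_le_sum key
    rw [Finset.sum_sub_distrib, Finset.sum_add_distrib, ← Finset.sum_mul, ← Finset.sum_mul,
      ← hA] at hs
    have h1 : (∑ i ∈ s, v i) * (A / V) ≤ V * (A / V) :=
      mul_le_mul_of_nonneg_right hV (by positivity)
    have h2 : V * (A / V) = A := by field_simp
    linarith

/-! ### Finitely supported laws on a monoid -/

namespace MonoidAlgebra

variable {M : Type*}

/-- `P` is absolutely continuous with respect to `Q` and the Kullback-Leibler divergence of `P`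
from `Q` (in nats) is at most `c`. -/
def DivLE (P Q : MonoidAlgebra ℝ M) (c : ℝ) : Prop :=
  (∀ m, 0 < P.coeff m → 0 < Q.coeff m) ∧
    ∑ m ∈ P.coeff.support, P.coeff m * (Real.log (P.coeff m) - Real.log (Q.coeff m)) ≤ c

lemma DivLE.mono {P Q : MonoidAlgebra ℝ M} {c c' : ℝ} (h : DivLE P Q c) (hc : c ≤ c') :
    DivLE P Q c' := ⟨h.1, h.2.trans hc⟩

lemma sum_div_of_support_subset (P Q : MonoidAlgebra ℝ M) {s : Finset M}
    (hs : P.coeff.support ⊆ s) :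
    ∑ m ∈ P.coeff.support, P.coeff m * (Real.log (P.coeff m) - Real.log (Q.coeff m)) =
      ∑ m ∈ s, P.coeff m * (Real.log (P.coeff m) - Real.log (Q.coeff m)) :=
  Finset.sum_subset hs fun m _ hm => by
    rw [Finsupp.notMem_support_iff.1 hm, zero_mul]

lemma divLE_self (P : MonoidAlgebra ℝ M) : DivLE P P 0 :=
  ⟨fun _ h => h, by simp⟩

variable [Monoid M]

/-- The total mass of a finitely supported signed measure on a monoid. -/
def mass (M : Type*) [Monoid M] : MonoidAlgebra ℝ M →ₐ[ℝ] ℝ := MonoidAlgebra.lift ℝ ℝ M 1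

lemma mass_apply (P : MonoidAlgebra ℝ M) : mass M P = ∑ m ∈ P.coeff.support, P.coeff m := by
  simp [mass, MonoidAlgebra.lift_apply, Finsupp.sum]

lemma mass_single (m : M) (r : ℝ) : mass M (single m r) = r := by
  simp [mass]

/-- `P` is a finitely supported probability measure. -/
def IsLaw (P : MonoidAlgebra ℝ M) : Prop := (∀ m, 0 ≤ P.coeff m) ∧ mass M P = 1

open Classical in
lemma coeff_mul_eq_sum (P Q : MonoidAlgebra ℝ M) {s t : Finset M}
    (hs : P.coeff.support ⊆ s) (ht : Q.coeff.support ⊆ t) (m : M) :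
    (P * Q).coeff m = ∑ u ∈ (s ×ˢ t) with u.1 * u.2 = m, P.coeff u.1 * Q.coeff u.2 := by
  rw [coeff_mul, Finset.sum_filter, Finset.sum_product,
    Finsupp.sum_of_support_subset _ hs _ (by simp)]
  refine Finset.sum_congr rfl fun a _ => ?_
  rw [Finsupp.sum_of_support_subset _ ht _ (by simp)]

lemma coeff_mul_nonneg {P Q : MonoidAlgebra ℝ M} (hP : ∀ m, 0 ≤ P.coeff m)
    (hQ : ∀ m, 0 ≤ Q.coeff m) (m : M) : 0 ≤ (P * Q).coeff m := by
  rw [coeff_mul_eq_sum P Q subset_rfl subset_rfl]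
  exact Finset.sum_nonneg fun u _ => mul_nonneg (hP _) (hQ _)

lemma IsLaw.mul {P Q : MonoidAlgebra ℝ M} (hP : IsLaw P) (hQ : IsLaw Q) : IsLaw (P * Q) :=
  ⟨coeff_mul_nonneg hP.1 hQ.1, by rw [map_mul, hP.2, hQ.2, one_mul]⟩

lemma isLaw_single (m : M) : IsLaw (single m (1 : ℝ)) :=
  ⟨fun m' => by
    classical
    rw [coeff_single, Finsupp.single_apply]
    split_ifs <;> norm_num, mass_single m 1⟩

lemma isLaw_one : IsLaw (1 : MonoidAlgebra ℝ M) := isLaw_single 1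

lemma IsLaw.convex {P Q : MonoidAlgebra ℝ M} (hP : IsLaw P) (hQ : IsLaw Q) {a b : ℝ}
    (ha : 0 ≤ a) (hb : 0 ≤ b) (hab : a + b = 1) : IsLaw (a • P + b • Q) := by
  refine ⟨fun m => ?_, ?_⟩
  · simpa using add_nonneg (mul_nonneg ha (hP.1 m)) (mul_nonneg hb (hQ.1 m))
  · rw [map_add, map_smul, map_smul, hP.2, hQ.2]
    simpa using hab

/-- If `P ≤ κ Q` pointwise, then the divergence of `P` from `Q` is at most `log κ`. -/
lemma divLE_log_of_le_mul {P Q : MonoidAlgebra ℝ M} (hP : IsLaw P) {κ : ℝ} (hκ : 0 < κ)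
    (h : ∀ m, P.coeff m ≤ κ * Q.coeff m) : DivLE P Q (Real.log κ) := by
  have hac : ∀ m, 0 < P.coeff m → 0 < Q.coeff m := fun m hm =>
    pos_of_mul_pos_right (hm.trans_le (h m)) hκ.le
  refine ⟨hac, ?_⟩
  have : ∀ m ∈ P.coeff.support, P.coeff m * (Real.log (P.coeff m) - Real.log (Q.coeff m)) ≤
      P.coeff m * Real.log κ := by
    intro m hm
    have hpos : 0 < P.coeff m := (hP.1 m).lt_of_ne' (Finsupp.mem_support_iff.1 hm)
    refine mul_le_mul_of_nonneg_left ?_ hpos.le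
    have := Real.log_le_log hpos (h m)
    rw [Real.log_mul hκ.ne' (hac m hpos).ne'] at this
    linarith
  refine (Finset.sum_le_sum this).trans ?_
  rw [← Finset.sum_mul, ← mass_apply, hP.2, one_mul]

/-- Joint convexity of the divergence. -/
lemma DivLE.convex {P₁ P₂ Q₁ Q₂ : MonoidAlgebra ℝ M} {c₁ c₂ a b : ℝ} (h₁ : DivLE P₁ Q₁ c₁)
    (h₂ : DivLE P₂ Q₂ c₂) (hP₁ : IsLaw P₁) (hP₂ : IsLaw P₂) (hQ₁ : IsLaw Q₁) (hQ₂ : IsLaw Q₂)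
    (ha : 0 ≤ a) (hb : 0 ≤ b) :
    DivLE (a • P₁ + b • P₂) (a • Q₁ + b • Q₂) (a * c₁ + b * c₂) := by
  classical
  have scale : ∀ {t p q : ℝ}, 0 ≤ t → 0 ≤ p → (0 < p → 0 < q) →
      t * p * (Real.log (t * p) - Real.log (t * q)) = t * (p * (Real.log p - Real.log q)) := by
    intro t p q ht hp hq
    rcases ht.eq_or_lt with rfl | ht
    · simp
    rcases hp.eq_or_lt with rfl | hp
    · simp
    rw [Real.log_mul ht.ne' hp.ne', Real.log_mul ht.ne' (hq hp).ne']
    ring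
  have acs : ∀ {t p q : ℝ}, 0 ≤ t → 0 ≤ p → (0 < p → 0 < q) → 0 < t * p → 0 < t * q := by
    intro t p q ht hp hq h
    have ht' : 0 < t := pos_of_mul_pos_left h hp
    exact mul_pos ht' (hq (pos_of_mul_pos_right h ht))
  refine ⟨fun m hm => ?_, ?_⟩
  · simp only [coeff_add, coeff_smul, Finsupp.add_apply, Finsupp.smul_apply, smul_eq_mul] at hm ⊢
    have hn₁ := mul_nonneg ha (hQ₁.1 m)
    have hn₂ := mul_nonneg hb (hQ₂.1 m)
    rcases (mul_nonneg ha (hP₁.1 m)).eq_or_lt with h | h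
    · rw [← h, zero_add] at hm
      have := acs hb (hP₂.1 m) (h₂.1 m) hm
      linarith
    · have := acs ha (hP₁.1 m) (h₁.1 m) h
      linarith
  · set s := P₁.coeff.support ∪ P₂.coeff.support
    have hsub : (a • P₁ + b • P₂).coeff.support ⊆ s := by
      intro m hm
      rw [Finset.mem_union, Finsupp.mem_support_iff, Finsupp.mem_support_iff]
      rw [Finsupp.mem_support_iff] at hm
      by_contra! hcon
      exact hm (by simp [hcon.1, hcon.2])
    have e₁ := h₁.2
    have e₂ := h₂.2
    rw [sum_div_of_support_subset P₁ Q₁ (s := s) Finset.subset_union_left] at e₁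
    rw [sum_div_of_support_subset P₂ Q₂ (s := s) Finset.subset_union_right] at e₂
    rw [sum_div_of_support_subset _ _ hsub]
    refine le_trans ?_ (add_le_add (mul_le_mul_of_nonneg_left e₁ ha)
      (mul_le_mul_of_nonneg_left e₂ hb))
    rw [Finset.mul_sum, Finset.mul_sum, ← Finset.sum_add_distrib]
    refine Finset.sum_le_sum fun m _ => ?_
    have := log_sum_le (Finset.univ : Finset Bool)
      (fun i => if i then a * P₁.coeff m else b * P₂.coeff m)
      (fun i => if i then a * Q₁.coeff m else b * Q₂.coeff m)
      (a * Q₁.coeff m + b * Q₂.coeff m)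
      (by rintro (_ | _) - <;> simp [ha, hb, hP₁.1 m, hP₂.1 m, mul_nonneg])
      (by rintro (_ | _) - <;> simp [ha, hb, hQ₁.1 m, hQ₂.1 m, mul_nonneg])
      (by
        rintro (_ | _) - h
        · exact acs hb (hP₂.1 m) (h₂.1 m) (by simpa using h)
        · exact acs ha (hP₁.1 m) (h₁.1 m) (by simpa using h))
      (by simp)
    simpa [scale ha (hP₁.1 m) (h₁.1 m), scale hb (hP₂.1 m) (h₂.1 m)] using this

/-- The divergence is subadditive under convolution. -/
lemma DivLE.mul {P₁ P₂ Q₁ Q₂ : MonoidAlgebra ℝ M} {c₁ c₂ : ℝ} (h₁ : DivLE P₁ Q₁ c₁)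
    (h₂ : DivLE P₂ Q₂ c₂) (hP₁ : IsLaw P₁) (hP₂ : IsLaw P₂) (hQ₁ : IsLaw Q₁) (hQ₂ : IsLaw Q₂) :
    DivLE (P₁ * P₂) (Q₁ * Q₂) (c₁ + c₂) := by
  classical
  set s₁ := P₁.coeff.support ∪ Q₁.coeff.support
  set s₂ := P₂.coeff.support ∪ Q₂.coeff.support
  have hP := coeff_mul_eq_sum P₁ P₂ (s := s₁) (t := s₂) Finset.subset_union_left
    Finset.subset_union_left
  have hQ := coeff_mul_eq_sum Q₁ Q₂ (s := s₁) (t := s₂) Finset.subset_union_right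
    Finset.subset_union_right
  have ac : ∀ u v, 0 < P₁.coeff u * P₂.coeff v → 0 < Q₁.coeff u * Q₂.coeff v := by
    intro u v h
    exact mul_pos (h₁.1 u (pos_of_mul_pos_left h (hP₂.1 v)))
      (h₂.1 v (pos_of_mul_pos_right h (hP₁.1 u)))
  have hQ0 : ∀ u : M × M, 0 ≤ Q₁.coeff u.1 * Q₂.coeff u.2 := fun u =>
    mul_nonneg (hQ₁.1 _) (hQ₂.1 _)
  have hP0 : ∀ u : M × M, 0 ≤ P₁.coeff u.1 * P₂.coeff u.2 := fun u =>
    mul_nonneg (hP₁.1 _) (hP₂.1 _)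
  refine ⟨fun m hm => ?_, ?_⟩
  · rw [hP] at hm
    rw [hQ]
    obtain ⟨u, hu, hpos⟩ := Finset.exists_lt_of_sum_lt (f := fun _ => (0 : ℝ)) (by simpa using hm)
    exact Finset.sum_pos' (fun u _ => hQ0 u) ⟨u, hu, ac _ _ hpos⟩
  · have hsub : (P₁ * P₂).coeff.support ⊆ (s₁ ×ˢ s₂).image fun u => u.1 * u.2 := by
      intro m hm
      rw [Finsupp.mem_support_iff, hP] at hm
      obtain ⟨u, hu, -⟩ := Finset.exists_ne_zero_of_sum_ne_zero hm
      rw [Finset.mem_filter] at hu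
      exact Finset.mem_image.2 ⟨u, hu⟩
    rw [sum_div_of_support_subset _ _ hsub]
    have step : ∀ m ∈ (s₁ ×ˢ s₂).image fun u => u.1 * u.2,
        (P₁ * P₂).coeff m * (Real.log ((P₁ * P₂).coeff m) - Real.log ((Q₁ * Q₂).coeff m)) ≤
        ∑ u ∈ (s₁ ×ˢ s₂) with u.1 * u.2 = m, P₁.coeff u.1 * P₂.coeff u.2 *
          (Real.log (P₁.coeff u.1 * P₂.coeff u.2) - Real.log (Q₁.coeff u.1 * Q₂.coeff u.2)) := by
      intro m _
      rw [hP]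
      exact log_sum_le _ _ _ _ (fun u _ => hP0 u) (fun u _ => hQ0 u) (fun u _ => ac _ _)
        (hQ m).ge
    refine (Finset.sum_le_sum step).trans ?_
    rw [Finset.sum_fiberwise_of_maps_to (g := fun u : M × M => u.1 * u.2)
      (fun u hu => Finset.mem_image_of_mem _ hu)]
    have split : ∀ u ∈ s₁ ×ˢ s₂, P₁.coeff u.1 * P₂.coeff u.2 *
          (Real.log (P₁.coeff u.1 * P₂.coeff u.2) - Real.log (Q₁.coeff u.1 * Q₂.coeff u.2)) =
        P₁.coeff u.1 * (Real.log (P₁.coeff u.1) - Real.log (Q₁.coeff u.1)) * P₂.coeff u.2 +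
        P₁.coeff u.1 *
          (P₂.coeff u.2 * (Real.log (P₂.coeff u.2) - Real.log (Q₂.coeff u.2))) := by
      intro u _
      rcases (hP₁.1 u.1).eq_or_lt with h | h
      · simp [← h]
      rcases (hP₂.1 u.2).eq_or_lt with h' | h'
      · simp [← h']
      rw [Real.log_mul h.ne' h'.ne', Real.log_mul (h₁.1 _ h).ne' (h₂.1 _ h').ne']
      ring
    have m₁ : ∑ u ∈ s₁, P₁.coeff u = 1 := by
      rw [← hP₁.2, mass_apply]
      exact (Finset.sum_subset Finset.subset_union_left fun m _ hm =>
        Finsupp.notMem_support_iff.1 hm).symm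
    have m₂ : ∑ u ∈ s₂, P₂.coeff u = 1 := by
      rw [← hP₂.2, mass_apply]
      exact (Finset.sum_subset Finset.subset_union_left fun m _ hm =>
        Finsupp.notMem_support_iff.1 hm).symm
    rw [Finset.sum_congr rfl split, Finset.sum_add_distrib, Finset.sum_product,
      Finset.sum_product]
    dsimp only
    rw [← Finset.sum_mul_sum, ← Finset.sum_mul_sum, m₁, m₂, mul_one, one_mul]
    refine add_le_add ?_ ?_
    · rw [← sum_div_of_support_subset P₁ Q₁ Finset.subset_union_left]
      exact h₁.2
    · rw [← sum_div_of_support_subset P₂ Q₂ Finset.subset_union_left]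
      exact h₂.2

end MonoidAlgebra

/-! ### Deletion laws on binary words -/

namespace DeletionLaw

open MonoidAlgebra

/-- The algebra of finitely supported signed measures on binary words. -/
abbrev WordAlg := MonoidAlgebra ℝ (FreeMonoid Bool)

/-- The law of the output when the single bit `b` is deleted with probability `d`. -/
def letter (d : ℝ) (b : Bool) : WordAlg := d • 1 + (1 - d) • single (FreeMonoid.of b) 1

/-- The law of the output of the deletion channel on the input word `z`. -/
def delLaw (d : ℝ) (z : List Bool) : WordAlg := (z.map (letter d)).prod

lemma delLaw_append (d : ℝ) (y z : List Bool) :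
    delLaw d (y ++ z) = delLaw d y * delLaw d z := by
  simp [delLaw]

lemma delLaw_cons (d : ℝ) (b : Bool) (z : List Bool) :
    delLaw d (b :: z) = letter d b * delLaw d z := by
  simp [delLaw]

lemma isLaw_letter {d : ℝ} (h0 : 0 ≤ d) (h1 : d ≤ 1) (b : Bool) : IsLaw (letter d b) :=
  isLaw_one.convex (isLaw_single _) h0 (sub_nonneg.2 h1) (by ring)

lemma isLaw_delLaw {d : ℝ} (h0 : 0 ≤ d) (h1 : d ≤ 1) (z : List Bool) : IsLaw (delLaw d z) := by
  induction z with
  | nil => exact isLaw_one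
  | cons b z ih =>
    rw [delLaw_cons]
    exact (isLaw_letter h0 h1 b).mul ih

/-- The law of a uniform random bit passed through the deletion channel. -/
def letterMix (d : ℝ) : WordAlg := (1 / 2 : ℝ) • letter d true + (1 / 2 : ℝ) • letter d false

lemma isLaw_letterMix {d : ℝ} (h0 : 0 ≤ d) (h1 : d ≤ 1) : IsLaw (letterMix d) :=
  (isLaw_letter h0 h1 true).convex (isLaw_letter h0 h1 false) (by norm_num) (by norm_num)
    (by norm_num)

lemma divLE_letter {d : ℝ} (h0 : 0 ≤ d) (h1 : d ≤ 1) (b : Bool) :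
    DivLE (letter d b) (letterMix d) (Real.log 2) := by
  refine divLE_log_of_le_mul (isLaw_letter h0 h1 b) two_pos fun m => ?_
  have ht := (isLaw_letter h0 h1 true).1 m
  have hf := (isLaw_letter h0 h1 false).1 m
  have e : (letterMix d).coeff m =
      1 / 2 * (letter d true).coeff m + 1 / 2 * (letter d false).coeff m := rfl
  rw [e]
  cases b <;> linarith

lemma exists_law_divLE_log_two {d : ℝ} (h0 : 0 ≤ d) (h1 : d ≤ 1) (r : ℕ) :
    ∃ Q : WordAlg, IsLaw Q ∧ ∀ z : List Bool, z.length = r →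
      DivLE (delLaw d z) Q (r * Real.log 2) := by
  induction r with
  | zero =>
    refine ⟨1, isLaw_one, fun z hz => ?_⟩
    rw [List.length_eq_zero_iff.1 hz]
    exact (divLE_self _).mono (by simp)
  | succ r ih =>
    obtain ⟨Q, hQ, h⟩ := ih
    refine ⟨letterMix d * Q, (isLaw_letterMix h0 h1).mul hQ, fun z hz => ?_⟩
    obtain ⟨b, z, rfl⟩ := List.exists_cons_of_length_eq_add_one hz
    rw [delLaw_cons]
    refine ((divLE_letter h0 h1 b).mul (h z (by simpa using hz)) (isLaw_letter h0 h1 b)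
      (isLaw_delLaw h0 h1 z) (isLaw_letterMix h0 h1) hQ).mono ?_
    push_cast
    linarith

/-- A reference law for block length `n` yields reference laws for every word length. -/
lemma exists_law_divLE_of_block {d c : ℝ} (h0 : 0 ≤ d) (h1 : d ≤ 1) (hc : 0 ≤ c) {n : ℕ}
    (hn : 0 < n) {Q₀ : WordAlg} (hQ₀ : IsLaw Q₀)
    (h : ∀ z : List Bool, z.length = n → DivLE (delLaw d z) Q₀ (n * c)) (m : ℕ) :
    ∃ Q : WordAlg, IsLaw Q ∧ ∀ z : List Bool, z.length = m →
      DivLE (delLaw d z) Q (m * c + n * Real.log 2) := by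
  have blocks : ∀ q r : ℕ, ∃ Q : WordAlg, IsLaw Q ∧ ∀ z : List Bool, z.length = n * q + r →
      DivLE (delLaw d z) Q (n * q * c + r * Real.log 2) := by
    intro q r
    induction q with
    | zero =>
      obtain ⟨Q, hQ, hr⟩ := exists_law_divLE_log_two h0 h1 r
      exact ⟨Q, hQ, fun z hz => (hr z (by simpa using hz)).mono (by simp)⟩
    | succ q ih =>
      obtain ⟨Q, hQ, hq⟩ := ih
      refine ⟨Q₀ * Q, hQ₀.mul hQ, fun z hz => ?_⟩
      rw [mul_add, mul_one] at hz
      rw [← List.take_append_drop n z, delLaw_append]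
      refine ((h (z.take n) (by rw [List.length_take]; omega)).mul
        (hq (z.drop n) (by rw [List.length_drop]; omega)) (isLaw_delLaw h0 h1 _)
        (isLaw_delLaw h0 h1 _) hQ₀ hQ).mono ?_
      push_cast
      linarith
  obtain ⟨Q, hQ, hm⟩ := blocks (m / n) (m % n)
  refine ⟨Q, hQ, fun z hz => (hm z (by rw [hz, Nat.div_add_mod])).mono ?_⟩
  have hr : ((m % n : ℕ) : ℝ) ≤ n := by exact_mod_cast (Nat.mod_lt m hn).le
  have hq : (n : ℝ) * ((m / n : ℕ) : ℝ) ≤ m := by exact_mod_cast Nat.mul_div_le m n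
  exact add_le_add (mul_le_mul_of_nonneg_right hq hc)
    (mul_le_mul_of_nonneg_right hr (Real.log_nonneg one_le_two))

/-- Deleting with probability `1 - t (1 - d)` amounts to keeping each bit with probability `t`
and passing the kept bits through the channel with deletion probability `d`. -/
lemma letter_thin (d t : ℝ) (b : Bool) :
    letter (1 - t * (1 - d)) b = (1 - t) • (1 : WordAlg) + t • letter d b := by
  unfold letter
  module

/-- Reference laws at deletion probability `d` for all word lengths yield reference laws at
deletion probability `1 - t (1 - d)`. -/
lemma exists_law_divLE_thin {d c K t : ℝ} (h0 : 0 ≤ d) (h1 : d ≤ 1) (t0 : 0 ≤ t) (t1 : t ≤ 1)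
    (h : ∀ m : ℕ, ∃ Q : WordAlg, IsLaw Q ∧ ∀ z : List Bool, z.length = m →
      DivLE (delLaw d z) Q (m * c + K)) (N : ℕ) :
    ∃ Q : WordAlg, IsLaw Q ∧ ∀ x : List Bool, x.length = N →
      DivLE (delLaw (1 - t * (1 - d)) x) Q (t * N * c + K) := by
  have hd0 : 0 ≤ 1 - t * (1 - d) := by nlinarith
  have hd1 : 1 - t * (1 - d) ≤ 1 := by nlinarith
  have mixed : ∀ N m : ℕ, ∃ Q : WordAlg, IsLaw Q ∧ ∀ z x : List Bool, z.length = m →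
      x.length = N →
      DivLE (delLaw d z * delLaw (1 - t * (1 - d)) x) Q ((m + t * N) * c + K) := by
    intro N
    induction N with
    | zero =>
      intro m
      obtain ⟨Q, hQ, hm⟩ := h m
      refine ⟨Q, hQ, fun z x hz hx => ?_⟩
      rw [List.length_eq_zero_iff.1 hx]
      simpa [delLaw] using hm z hz
    | succ N ih =>
      intro m
      obtain ⟨Q, hQ, hm⟩ := ih m
      obtain ⟨Q', hQ', hm'⟩ := ih (m + 1)
      refine ⟨(1 - t) • Q + t • Q', hQ.convex hQ' (by linarith) t0 (by ring),
        fun z x hz hx => ?_⟩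
      obtain ⟨b, x, rfl⟩ := List.exists_cons_of_length_eq_add_one hx
      have hx' : x.length = N := by simpa using hx
      have e : delLaw d z * delLaw (1 - t * (1 - d)) (b :: x) =
          (1 - t) • (delLaw d z * delLaw (1 - t * (1 - d)) x) +
            t • (delLaw d (z ++ [b]) * delLaw (1 - t * (1 - d)) x) := by
        rw [delLaw_cons, letter_thin, delLaw_append, add_mul, mul_add, smul_mul_assoc, one_mul,
          mul_smul_comm, smul_mul_assoc, mul_smul_comm, ← mul_assoc]
        simp [delLaw]
      rw [e]
      refine ((hm z x hz hx').convex (hm' (z ++ [b]) x (by simp [hz]) hx')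
        ((isLaw_delLaw h0 h1 _).mul (isLaw_delLaw hd0 hd1 _))
        ((isLaw_delLaw h0 h1 _).mul (isLaw_delLaw hd0 hd1 _)) hQ hQ'
        (by linarith) t0).mono (le_of_eq ?_)
      push_cast
      ring
  obtain ⟨Q, hQ, hN⟩ := mixed N 0
  refine ⟨Q, hQ, fun x hx => ?_⟩
  simpa [delLaw] using hN [] x rfl hx

/-! ### Comparison with the channel matrix -/

/-- The word underlying an output of the deletion channel. -/
def outWord {n : ℕ} (y : DelOut n) : FreeMonoid Bool := FreeMonoid.ofList (List.ofFn y.2)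

lemma outWord_injective (n : ℕ) : Function.Injective (outWord (n := n)) := by
  rintro ⟨k, y⟩ ⟨k', y'⟩ h
  have h' : List.ofFn y = List.ofFn y' := FreeMonoid.ofList.injective h
  have hk : k = k' := by
    have := congrArg List.length h'
    simp only [List.length_ofFn] at this
    exact Fin.ext this
  subst hk
  rw [List.ofFn_injective h']

lemma outWord_restrictSub {n : ℕ} (x : Fin n → Bool) (S : Finset (Fin n)) :
    outWord (restrictSub x S) =
      FreeMonoid.ofList (((List.finRange n).filter (· ∈ S)).map x) := by
  have hsort : (List.finRange n).filter (· ∈ S) = S.sort := by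
    refine List.Perm.eq_of_pairwise' (r := (· ≤ ·)) ?_ (S.pairwise_sort _) ?_
    · exact List.Pairwise.filter _ (List.pairwise_le_finRange n)
    · refine (List.perm_ext_iff_of_nodup ((List.nodup_finRange n).filter _)
        (S.sort_nodup _)).2 fun a => ?_
      simp
  rw [hsort, ← Finset.listMap_orderEmbOfFin_finRange S rfl, List.map_map, ← List.ofFn_eq_map]
  rfl

lemma sum_finset_fin_succ {A : Type*} [AddCommMonoid A] {n : ℕ} (f : Finset (Fin (n + 1)) → A) :
    ∑ S, f S = ∑ T : Finset (Fin n), f (T.image Fin.succ) +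
      ∑ T : Finset (Fin n), f (insert 0 (T.image Fin.succ)) := by
  have hinj : Function.Injective (Finset.image (Fin.succ (n := n))) :=
    Finset.image_injective (Fin.succ_injective n)
  have hu : (Finset.univ : Finset (Fin (n + 1))) =
      insert 0 ((Finset.univ : Finset (Fin n)).image Fin.succ) := by
    ext i
    refine Fin.cases ?_ (fun i => ?_) i <;> simp
  rw [← Finset.powerset_univ, hu, Finset.sum_powerset_insert (by simp), Finset.powerset_image,
    Finset.sum_image hinj.injOn, Finset.sum_image hinj.injOn, Finset.powerset_univ]

lemma delLaw_ofFn (d : ℝ) (n : ℕ) (x : Fin n → Bool) :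
    delLaw d (List.ofFn x) = ∑ S : Finset (Fin n),
      single (FreeMonoid.ofList (((List.finRange n).filter (· ∈ S)).map x))
        ((1 - d) ^ S.card * d ^ (n - S.card)) := by
  induction n with
  | zero => simp [delLaw, one_def, Finset.univ_unique, Finset.eq_empty_of_isEmpty]
  | succ n ih =>
    rw [List.ofFn_succ, delLaw_cons, ih, sum_finset_fin_succ, letter, add_mul, smul_mul_assoc,
      one_mul, smul_mul_assoc, Finset.mul_sum, Finset.smul_sum, Finset.smul_sum]
    have hcard : ∀ T : Finset (Fin n), (T.image Fin.succ).card = T.card := fun T =>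
      Finset.card_image_of_injective _ (Fin.succ_injective n)
    have hle : ∀ T : Finset (Fin n), T.card ≤ n := fun T => by
      simpa using Finset.card_le_univ T
    congr 1
    · refine Finset.sum_congr rfl fun T _ => ?_
      rw [smul_single, hcard, Nat.sub_add_comm (hle T), List.finRange_succ]
      congr 1
      · simp [List.filter_map, Function.comp_def]
      · simp only [smul_eq_mul]
        ring
    · refine Finset.sum_congr rfl fun T _ => ?_
      have h0 : (0 : Fin (n + 1)) ∉ T.image Fin.succ := by simp
      rw [single_mul_single, smul_single, Finset.card_insert_of_notMem h0, hcard,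
        Nat.add_sub_add_right, List.finRange_succ]
      congr 1
      · simp [List.filter_map, Function.comp_def]
      · simp only [smul_eq_mul]
        ring

lemma delW_eq_coeff {n : ℕ} (d : ℝ) (x : Fin n → Bool) (y : DelOut n) :
    delW d x y = (delLaw d (List.ofFn x)).coeff (outWord y) := by
  classical
  rw [delLaw_ofFn, coeff_sum, Finsupp.finsetSum_apply]
  refine Finset.sum_congr rfl fun S _ => ?_
  rw [← outWord_restrictSub, coeff_single, Finsupp.single_apply]
  simp only [(outWord_injective n).eq_iff]

lemma support_delLaw_subset {n : ℕ} (d : ℝ) (x : Fin n → Bool) :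
    ∀ m ∈ (delLaw d (List.ofFn x)).coeff.support, ∃ y : DelOut n, outWord y = m := by
  classical
  intro m hm
  rw [Finsupp.mem_support_iff, delLaw_ofFn, coeff_sum, Finsupp.finsetSum_apply] at hm
  obtain ⟨S, -, hS⟩ := Finset.exists_ne_zero_of_sum_ne_zero hm
  rw [← outWord_restrictSub, coeff_single, Finsupp.single_apply] at hS
  exact ⟨restrictSub x S, by_contra fun h => hS (if_neg h)⟩

lemma sum_outWord_eq {n : ℕ} (P : WordAlg)
    (hP : ∀ m ∈ P.coeff.support, ∃ y : DelOut n, outWord y = m) (g : FreeMonoid Bool → ℝ)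
    (hg : ∀ m, P.coeff m = 0 → g m = 0) :
    ∑ y : DelOut n, g (outWord y) = ∑ m ∈ P.coeff.support, g m := by
  classical
  rw [← Finset.sum_image (g := outWord) (f := g) (outWord_injective n).injOn]
  refine (Finset.sum_subset (fun m hm => ?_) fun m _ hm => ?_).symm
  · obtain ⟨y, rfl⟩ := hP m hm
    exact Finset.mem_image_of_mem _ (Finset.mem_univ y)
  · exact hg m (Finsupp.notMem_support_iff.1 hm)

lemma sum_coeff_outWord_le_one {n : ℕ} {Q : WordAlg} (hQ : IsLaw Q) :
    ∑ y : DelOut n, Q.coeff (outWord y) ≤ 1 := by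
  classical
  rw [← Finset.sum_image (g := outWord) (f := Q.coeff) (outWord_injective n).injOn,
    ← hQ.2, mass_apply, Finset.sum_subset (s₁ := Q.coeff.support)
      (Finset.subset_union_left (s₂ := Finset.univ.image (outWord (n := n))))
      fun m _ hm => Finsupp.notMem_support_iff.1 hm]
  exact Finset.sum_le_sum_of_subset_of_nonneg Finset.subset_union_right fun m _ _ => hQ.1 m

lemma delW_nonneg {n : ℕ} {d : ℝ} (h0 : 0 ≤ d) (h1 : d ≤ 1) (x : Fin n → Bool) (y : DelOut n) :
    0 ≤ delW d x y := by
  rw [delW_eq_coeff]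
  exact (isLaw_delLaw h0 h1 _).1 _

lemma sum_delW {n : ℕ} {d : ℝ} (h0 : 0 ≤ d) (h1 : d ≤ 1) (x : Fin n → Bool) :
    ∑ y, delW d x y = 1 := by
  simp only [delW_eq_coeff]
  rw [sum_outWord_eq (delLaw d (List.ofFn x)) (support_delLaw_subset d x) _ fun _ h => h,
    ← mass_apply, (isLaw_delLaw h0 h1 _).2]

lemma sum_div_delW {n : ℕ} (d : ℝ) (x : Fin n → Bool) (Q : WordAlg) :
    ∑ y, delW d x y * (Real.log (delW d x y) - Real.log (Q.coeff (outWord y))) =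
      ∑ m ∈ (delLaw d (List.ofFn x)).coeff.support, (delLaw d (List.ofFn x)).coeff m *
        (Real.log ((delLaw d (List.ofFn x)).coeff m) - Real.log (Q.coeff m)) := by
  simp only [delW_eq_coeff]
  exact sum_outWord_eq (delLaw d (List.ofFn x)) (support_delLaw_subset d x)
    (fun m => (delLaw d (List.ofFn x)).coeff m *
      (Real.log ((delLaw d (List.ofFn x)).coeff m) - Real.log (Q.coeff m)))
    fun m h => by rw [h, zero_mul]

/-- A distribution on channel outputs as a law on binary words. -/
lemma exists_law_of_isDist {n : ℕ} {q : DelOut n → ℝ} (hq : IsDist q) :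
    ∃ Q : WordAlg, IsLaw Q ∧ ∀ y, Q.coeff (outWord y) = q y := by
  classical
  have hcoeff : ∀ m, (∑ y : DelOut n, single (outWord y) (q y) : WordAlg).coeff m =
      ∑ y : DelOut n, if outWord y = m then q y else 0 := fun m => by
    simp [coeff_sum, Finsupp.finsetSum_apply, Finsupp.single_apply]
  refine ⟨∑ y : DelOut n, single (outWord y) (q y), ⟨fun m => ?_, ?_⟩, fun y => ?_⟩
  · rw [hcoeff]
    exact Finset.sum_nonneg fun y _ => by split_ifs <;> simp [hq.1 y]
  · simp only [map_sum, mass_single]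
    exact hq.2
  · rw [hcoeff]
    simp [(outWord_injective n).eq_iff]

end DeletionLaw

/-! ### Capacity and reference distributions -/

namespace Channel

variable {α β : Type*} [Fintype α]

/-- The output distribution of the channel `W` with input distribution `p`. -/
def output (W : α → β → ℝ) (p : α → ℝ) (y : β) : ℝ := ∑ x, p x * W x y

variable {W : α → β → ℝ}

lemma output_nonneg (hW : ∀ x y, 0 ≤ W x y) {p : α → ℝ} (hp : IsDist p) (y : β) :
    0 ≤ output W p y :=
  Finset.sum_nonneg fun x _ => mul_nonneg (hp.1 x) (hW x y)

lemma output_pos (hW : ∀ x y, 0 ≤ W x y) {p : α → ℝ} (hp : IsDist p) {x : α} {y : β}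
    (hx : 0 < p x) (hy : 0 < W x y) : 0 < output W p y :=
  Finset.sum_pos' (fun x _ => mul_nonneg (hp.1 x) (hW x y)) ⟨x, Finset.mem_univ x, mul_pos hx hy⟩

lemma output_mix [DecidableEq α] (p : α → ℝ) (x : α) (t : ℝ) (y : β) :
    output W (fun a => (1 - t) * p a + t * (Pi.single x 1 : α → ℝ) a) y =
      (1 - t) * output W p y + t * W x y := by
  simp only [output, add_mul, Finset.sum_add_distrib, Finset.mul_sum, mul_assoc]
  simp [Pi.single_apply]

variable [Fintype β]

/-- The mutual information in nats, written as a difference of entropies. -/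
def infoNat (W : α → β → ℝ) (p : α → ℝ) : ℝ :=
  ∑ x, p x * ∑ y, W x y * Real.log (W x y) + ∑ y, Real.negMulLog (output W p y)

lemma continuous_infoNat (W : α → β → ℝ) : Continuous (infoNat W) := by
  unfold infoNat output
  fun_prop

lemma output_isDist (hW : ∀ x y, 0 ≤ W x y) (hW1 : ∀ x, ∑ y, W x y = 1) {p : α → ℝ}
    (hp : IsDist p) : IsDist (output W p) := by
  refine ⟨output_nonneg hW hp, ?_⟩
  unfold output
  rw [Finset.sum_comm]
  simp only [← Finset.mul_sum, hW1, mul_one]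
  exact hp.2

lemma sum_output_mul (p : α → ℝ) (g : β → ℝ) :
    ∑ y, output W p y * g y = ∑ x, p x * ∑ y, W x y * g y := by
  simp only [output, Finset.sum_mul, Finset.mul_sum, mul_assoc]
  exact Finset.sum_comm

lemma infoNat_eq_sum_div (p : α → ℝ) :
    infoNat W p =
      ∑ x, p x * ∑ y, W x y * (Real.log (W x y) - Real.log (output W p y)) := by
  simp only [mul_sub, Finset.sum_sub_distrib]
  rw [infoNat, ← sum_output_mul, sub_eq_add_neg, ← Finset.sum_neg_distrib]
  simp only [Real.negMulLog, neg_mul]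

lemma mutualInfo_mul_log_two (hW : ∀ x y, 0 ≤ W x y) {p : α → ℝ} (hp : IsDist p) :
    mutualInfo p W * Real.log 2 = infoNat W p := by
  rw [infoNat_eq_sum_div, mutualInfo, Finset.sum_mul]
  refine Finset.sum_congr rfl fun x _ => ?_
  rw [Finset.sum_mul, Finset.mul_sum]
  refine Finset.sum_congr rfl fun y _ => ?_
  rcases (hp.1 x).eq_or_lt with h | h
  · simp [← h]
  rcases (hW x y).eq_or_lt with h' | h'
  · simp [← h']
  have ho := output_pos hW hp h h'
  change p x * W x y * Real.logb 2 (W x y / output W p y) * Real.log 2 = _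
  rw [Real.logb, Real.log_div h'.ne' ho.ne']
  have : Real.log 2 ≠ 0 := (Real.log_pos one_lt_two).ne'
  field_simp

/-- Gibbs' inequality. -/
lemma sum_mul_log_le {w v : β → ℝ} (hw : IsDist w) (hv : ∀ y, 0 ≤ v y) (hv1 : ∑ y, v y ≤ 1)
    (hwv : ∀ y, 0 < w y → 0 < v y) :
    ∑ y, w y * Real.log (v y) ≤ ∑ y, w y * Real.log (w y) := by
  have := log_sum_le Finset.univ w v 1 (fun y _ => hw.1 y) (fun y _ => hv y)
    (fun y _ => hwv y) hv1
  rw [hw.2] at this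
  simp only [mul_sub, Finset.sum_sub_distrib] at this
  linarith

lemma mutualInfo_nonneg (hW : ∀ x y, 0 ≤ W x y) (hW1 : ∀ x, ∑ y, W x y = 1) {p : α → ℝ}
    (hp : IsDist p) : 0 ≤ mutualInfo p W := by
  refine nonneg_of_mul_nonneg_left ?_ (Real.log_pos one_lt_two)
  rw [mutualInfo_mul_log_two hW hp, infoNat_eq_sum_div]
  refine Finset.sum_nonneg fun x _ => ?_
  rcases (hp.1 x).eq_or_lt with h | h
  · simp [← h]
  refine mul_nonneg h.le ?_
  have := sum_mul_log_le (w := W x) (v := output W p) ⟨hW x, hW1 x⟩ (output_nonneg hW hp)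
    (output_isDist hW hW1 hp).2.le fun y hy => output_pos hW hp h hy
  simp only [mul_sub, Finset.sum_sub_distrib]
  linarith

/-- The mutual information is bounded by the largest divergence from a reference distribution. -/
lemma mutualInfo_mul_log_two_le (hW : ∀ x y, 0 ≤ W x y) (hW1 : ∀ x, ∑ y, W x y = 1) {p : α → ℝ}
    (hp : IsDist p) {v : β → ℝ} (hv : ∀ y, 0 ≤ v y) (hv1 : ∑ y, v y ≤ 1)
    (hac : ∀ x y, 0 < W x y → 0 < v y) {c : ℝ}
    (hc : ∀ x, ∑ y, W x y * (Real.log (W x y) - Real.log (v y)) ≤ c) :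
    mutualInfo p W * Real.log 2 ≤ c := by
  rw [mutualInfo_mul_log_two hW hp]
  have hg := sum_mul_log_le (output_isDist hW hW1 hp) hv hv1 fun y hy => by
    obtain ⟨x, -, hx⟩ := Finset.exists_lt_of_sum_lt (f := fun _ => (0 : ℝ))
      (g := fun x => p x * W x y) (s := Finset.univ) (by simpa [output] using hy)
    exact hac x y (pos_of_mul_pos_right hx (hp.1 x))
  have hs : ∑ x, p x * ∑ y, W x y * (Real.log (W x y) - Real.log (v y)) ≤ ∑ x, p x * c :=
    Finset.sum_le_sum fun x _ => mul_le_mul_of_nonneg_left (hc x) (hp.1 x)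
  rw [← Finset.sum_mul, hp.2, one_mul] at hs
  simp only [mul_sub, Finset.sum_sub_distrib] at hs
  rw [← sum_output_mul p fun y => Real.log (v y)] at hs
  rw [infoNat]
  simp only [Real.negMulLog, neg_mul, Finset.sum_neg_distrib]
  linarith

/-- At a maximiser of the mutual information, every row of the channel matrix has divergence at
most the capacity from each perturbed output distribution. -/
lemma div_mix_le (hW : ∀ x y, 0 ≤ W x y) (hW1 : ∀ x, ∑ y, W x y = 1) {p : α → ℝ}
    (hp : IsDist p) (hmax : ∀ p', IsDist p' → infoNat W p' ≤ infoNat W p) (x : α) {t : ℝ}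
    (t0 : 0 < t) (t1 : t < 1) :
    ∑ y, W x y * Real.log (W x y) -
      ∑ y, W x y * Real.log ((1 - t) * output W p y + t * W x y) ≤ infoNat W p := by
  classical
  set p' : α → ℝ := fun a => (1 - t) * p a + t * (Pi.single x 1 : α → ℝ) a with hp'
  have s1 : ∀ a, (0 : ℝ) ≤ (Pi.single x 1 : α → ℝ) a := fun a => by
    rw [Pi.single_apply]
    split_ifs <;> norm_num
  have hd : IsDist p' := by
    refine ⟨fun a => add_nonneg (mul_nonneg (by linarith) (hp.1 a)) (mul_nonneg t0.le (s1 a)), ?_⟩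
    simp only [hp', Finset.sum_add_distrib, ← Finset.mul_sum, hp.2]
    simp
  have hq' : ∀ y, output W p' y = (1 - t) * output W p y + t * W x y := output_mix p x t
  have h := hmax p' hd
  have hg := sum_mul_log_le (output_isDist hW hW1 hp) (output_nonneg hW hd)
    (output_isDist hW hW1 hd).2.le fun y hy => by
      rw [hq']
      exact add_pos_of_pos_of_nonneg (mul_pos (by linarith) hy) (mul_nonneg t0.le (hW x y))
  have e1 : ∑ a, p' a * ∑ y, W a y * Real.log (W a y) =
      (1 - t) * ∑ a, p a * ∑ y, W a y * Real.log (W a y) +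
        t * ∑ y, W x y * Real.log (W x y) := by
    simp only [hp', add_mul, Finset.sum_add_distrib, mul_assoc]
    rw [← Finset.mul_sum]
    simp [Pi.single_apply]
  have e2 : ∑ y, output W p' y * Real.log (output W p' y) =
      (1 - t) * ∑ y, output W p y * Real.log (output W p' y) +
        t * ∑ y, W x y * Real.log (output W p' y) := by
    rw [Finset.mul_sum, Finset.mul_sum, ← Finset.sum_add_distrib]
    refine Finset.sum_congr rfl fun y _ => ?_
    nth_rewrite 1 [hq']
    ring
  simp only [← hq']
  simp only [infoNat, Real.negMulLog, neg_mul, Finset.sum_neg_distrib] at h ⊢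
  rw [e1, e2] at h
  have hg' := mul_le_mul_of_nonneg_left hg (by linarith : 0 ≤ 1 - t)
  refine le_of_mul_le_mul_left ?_ t0
  linarith

/-- Every channel has a reference output distribution from which every row of the channel matrix
has divergence at most the capacity. -/
lemma exists_reference [Nonempty α] (hW : ∀ x y, 0 ≤ W x y) (hW1 : ∀ x, ∑ y, W x y = 1) :
    ∃ q : β → ℝ, IsDist q ∧ ∀ x, (∀ y, 0 < W x y → 0 < q y) ∧
      ∑ y, W x y * (Real.log (W x y) - Real.log (q y)) ≤
        (⨆ p : {p : α → ℝ // IsDist p}, mutualInfo p.1 W) * Real.log 2 := by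
  classical
  have hl2 : 0 < Real.log 2 := Real.log_pos one_lt_two
  have hne : (stdSimplex ℝ α).Nonempty :=
    ⟨_, single_mem_stdSimplex ℝ (Classical.arbitrary α)⟩
  obtain ⟨p, hp, hmax⟩ := (isCompact_stdSimplex ℝ α).exists_isMaxOn hne
    (continuous_infoNat W).continuousOn
  have hp : IsDist p := hp
  have hmax : ∀ p', IsDist p' → infoNat W p' ≤ infoNat W p := fun p' h => hmax h
  have hbdd : BddAbove (Set.range fun p : {p : α → ℝ // IsDist p} => mutualInfo p.1 W) := by
    refine ⟨infoNat W p / Real.log 2, ?_⟩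
    rintro _ ⟨p', rfl⟩
    rw [le_div_iff₀ hl2, mutualInfo_mul_log_two hW p'.2]
    exact hmax _ p'.2
  have hsup : infoNat W p ≤
      (⨆ p : {p : α → ℝ // IsDist p}, mutualInfo p.1 W) * Real.log 2 := by
    rw [← mutualInfo_mul_log_two hW hp]
    exact mul_le_mul_of_nonneg_right (le_ciSup hbdd ⟨p, hp⟩) hl2.le
  refine ⟨output W p, output_isDist hW hW1 hp, fun x => ?_⟩
  have hq := output_isDist hW hW1 hp
  have hev : ∀ᶠ t : ℝ in nhdsWithin 0 (Set.Ioi 0), 0 < t ∧ t < 1 :=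
    Ioo_mem_nhdsGT one_pos
  have hlim : ∀ y, Filter.Tendsto (fun t : ℝ => (1 - t) * output W p y + t * W x y)
      (nhdsWithin 0 (Set.Ioi 0)) (nhds (output W p y)) := fun y => by
    have hc : Continuous fun t : ℝ => (1 - t) * output W p y + t * W x y := by fun_prop
    simpa using (hc.tendsto 0).mono_left nhdsWithin_le_nhds
  have hac : ∀ y, 0 < W x y → 0 < output W p y := by
    intro y hy
    set B := infoNat W p - ∑ y, W x y * Real.log (W x y)
    refine lt_of_lt_of_le (Real.exp_pos (-B / W x y)) (ge_of_tendsto (hlim y) ?_)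
    filter_upwards [hev] with t ⟨t0, t1⟩
    have hpos : 0 < (1 - t) * output W p y + t * W x y :=
      add_pos_of_nonneg_of_pos (mul_nonneg (by linarith) (hq.1 y)) (mul_pos t0 hy)
    rw [← Real.le_log_iff_exp_le hpos, div_le_iff₀ hy]
    have hle := div_mix_le hW hW1 hp hmax x t0 t1
    have hterm : ∀ z, W x z * Real.log ((1 - t) * output W p z + t * W x z) ≤ 0 := by
      intro z
      refine mul_nonpos_of_nonneg_of_nonpos (hW x z) (Real.log_nonpos ?_ ?_)
      · exact add_nonneg (mul_nonneg (by linarith) (hq.1 z)) (mul_nonneg t0.le (hW x z))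
      · have h1 : output W p z ≤ 1 :=
          hq.2 ▸ Finset.single_le_sum (fun y _ => hq.1 y) (Finset.mem_univ z)
        have h2 : W x z ≤ 1 :=
          hW1 x ▸ Finset.single_le_sum (fun y _ => hW x y) (Finset.mem_univ z)
        nlinarith
    have hsum : ∑ z, W x z * Real.log ((1 - t) * output W p z + t * W x z) ≤
        W x y * Real.log ((1 - t) * output W p y + t * W x y) := by
      rw [← Finset.add_sum_erase _ _ (Finset.mem_univ y)]
      have := Finset.sum_nonpos fun z (_ : z ∈ Finset.univ.erase y) => hterm z
      linarith
    simp only [B]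
    linarith
  refine ⟨hac, le_trans ?_ hsup⟩
  simp only [mul_sub, Finset.sum_sub_distrib]
  refine le_of_tendsto (f := fun t : ℝ => ∑ y, W x y * Real.log (W x y) -
    ∑ y, W x y * Real.log ((1 - t) * output W p y + t * W x y))
    (x := nhdsWithin 0 (Set.Ioi 0)) ?_ ?_
  · refine tendsto_const_nhds.sub (tendsto_finsetSum _ fun y _ => ?_)
    rcases (hW x y).eq_or_lt with h | h
    · simp [← h]
    · exact ((hlim y).log (hac y h).ne').const_mul _
  · filter_upwards [hev] with t ⟨t0, t1⟩
    exact div_mix_le hW hW1 hp hmax x t0 t1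

end Channel

/-! ### The bound on the limit -/

open DeletionLaw MonoidAlgebra in
/-- Thinning the input of the deletion channel scales the capacity bound given by a fixed block
length. -/
theorem C_thin_le {n : ℕ} (hn : 0 < n) {d t : ℝ} (h0 : 0 ≤ d) (h1 : d ≤ 1) (t0 : 0 ≤ t)
    (t1 : t ≤ 1) : C (1 - t * (1 - d)) ≤ t * Cn n d := by
  have hl2 : 0 < Real.log 2 := Real.log_pos one_lt_two
  have hn' : (0 : ℝ) < n := Nat.cast_pos.2 hn
  have hd0 : 0 ≤ 1 - t * (1 - d) := by nlinarith
  have hd1 : 1 - t * (1 - d) ≤ 1 := by nlinarith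
  have hCn : ∀ (k : ℕ) {e : ℝ}, 0 ≤ e → e ≤ 1 → 0 ≤ Cn k e := fun k e e0 e1 =>
    mul_nonneg (by positivity) (Real.iSup_nonneg fun p =>
      Channel.mutualInfo_nonneg (delW_nonneg e0 e1) (sum_delW e0 e1) p.2)
  obtain ⟨q, hq, hqx⟩ := Channel.exists_reference (delW_nonneg (n := n) h0 h1) (sum_delW h0 h1)
  obtain ⟨Q₀, hQ₀, hQ₀q⟩ := exists_law_of_isDist hq
  have hsup : (⨆ p : {p : (Fin n → Bool) → ℝ // IsDist p}, mutualInfo p.1 (delW d)) =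
      n * Cn n d := by
    rw [Cn]
    field_simp
  have hblock : ∀ z : List Bool, z.length = n →
      DivLE (delLaw d z) Q₀ (n * (Cn n d * Real.log 2)) := by
    rintro z rfl
    obtain ⟨hac, hle⟩ := hqx z.get
    have hz : List.ofFn z.get = z := List.ofFn_get z
    simp only [← hQ₀q] at hac hle
    rw [sum_div_delW, hz, hsup, mul_assoc] at hle
    refine ⟨fun m hm => ?_, hle⟩
    obtain ⟨y, rfl⟩ := support_delLaw_subset d z.get m
      (by rw [hz]; exact Finsupp.mem_support_iff.2 hm.ne')
    exact hac y (by rw [delW_eq_coeff, hz]; exact hm)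
  have hCN : ∀ N : ℕ, 0 < N → Cn N (1 - t * (1 - d)) ≤ t * Cn n d + n / N := by
    intro N hN
    obtain ⟨Q, hQ, hQx⟩ := exists_law_divLE_thin h0 h1 t0 t1
      (exists_law_divLE_of_block h0 h1 (mul_nonneg (hCn n h0 h1) hl2.le) hn hQ₀ hblock) N
    have hN' : (0 : ℝ) < N := Nat.cast_pos.2 hN
    have hbound : (⨆ p : {p : (Fin N → Bool) → ℝ // IsDist p},
        mutualInfo p.1 (delW (1 - t * (1 - d)))) ≤ t * N * Cn n d + n := by
      refine Real.iSup_le (fun p => ?_)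
        (add_nonneg (mul_nonneg (by positivity) (hCn n h0 h1)) hn'.le)
      refine le_of_mul_le_mul_right ?_ hl2
      refine (Channel.mutualInfo_mul_log_two_le (delW_nonneg hd0 hd1) (sum_delW hd0 hd1) p.2
        (v := fun y => Q.coeff (outWord y)) (fun y => hQ.1 _) (sum_coeff_outWord_le_one hQ)
        (fun x y hxy => ?_) (fun x => ?_)).trans
        (le_of_eq (by ring : t * N * (Cn n d * Real.log 2) + n * Real.log 2 = _))
      · rw [delW_eq_coeff] at hxy
        exact (hQx _ (List.length_ofFn)).1 _ hxy
      · rw [sum_div_delW]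
        exact (hQx _ (List.length_ofFn)).2
    rw [Cn]
    refine (mul_le_mul_of_nonneg_left hbound (by positivity)).trans (le_of_eq ?_)
    field_simp
  have hC : ∀ N : ℕ, 0 < N → C (1 - t * (1 - d)) ≤ t * Cn n d + n / N := fun N hN =>
    (ciInf_le (f := fun k : {m : ℕ // 1 ≤ m} => Cn k (1 - t * (1 - d)))
      ⟨0, by rintro _ ⟨k, rfl⟩; exact hCn k hd0 hd1⟩ ⟨N, hN⟩).trans (hCN N hN)
  have hlim : Filter.Tendsto (fun N : ℕ => t * Cn n d + (n : ℝ) / N) Filter.atTop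
      (nhds (t * Cn n d)) := by
    simpa using (tendsto_const_div_atTop_nhds_zero_nat (n : ℝ)).const_add (t * Cn n d)
  refine ge_of_tendsto hlim ?_
  filter_upwards [Filter.eventually_gt_atTop 0] with N hN
  exact hC N hN

/-- Assuming the numerical bound `C_17(0.65) ≤ 0.145`, the limit
`lim_{d→1⁻} C(d)/(1−d)` (which exists, taken along `d` tending to `1` from the left
within `(0,1)`) is at most `0.4143`. -/
theorem C_ratio_limit_le_numeric (hnum : Cn 17 (0.65 : ℝ) ≤ 0.145) (l : ℝ)
    (hlim : Filter.Tendsto (fun d : ℝ => C d / (1 - d)) (nhdsWithin 1 (Set.Ioo 0 1))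
      (nhds l)) :
    l ≤ 0.4143 := by
  have hnebot : (nhdsWithin (1 : ℝ) (Set.Ioo 0 1)).NeBot := right_nhdsWithin_Ioo_neBot one_pos
  refine le_of_tendsto hlim ?_
  have hnear : ∀ᶠ d in nhdsWithin (1 : ℝ) (Set.Ioo 0 1), (0.65 : ℝ) < d :=
    nhdsWithin_le_nhds (lt_mem_nhds (by norm_num))
  filter_upwards [hnear, self_mem_nhdsWithin] with d hd hd'
  have h1 : 0 < 1 - d := sub_pos.2 hd'.2
  have h := C_thin_le (n := 17) (by norm_num) (d := 0.65) (t := (1 - d) / 0.35) (by norm_num)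
    (by norm_num) (by positivity) (by rw [div_le_one (by norm_num)]; linarith)
  have e : 1 - (1 - d) / 0.35 * (1 - 0.65) = d := by
    norm_num
  rw [e] at h
  rw [div_le_iff₀ h1]
  have h2 := mul_le_mul_of_nonneg_left hnum (by positivity : 0 ≤ (1 - d) / 0.35)
  have h3 : (1 - d) / 0.35 * 0.145 ≤ 0.4143 * (1 - d) := by
    rw [div_mul_eq_mul_div, div_le_iff₀ (by norm_num)]
    nlinarith
  linarith
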